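/- arXiv:2509.10673 — 2 statements merged into one kernel-verified Lean document; each statement's English description precedes it below -/
import Mathlib

section
/- In the abelian group G = ℤ/5 × ℤ/5 × ℤ/9 (of order 225), the four 8-element subsets B₁ = {(0,0,0),(0,0,1),(0,1,2),(0,4,2),(1,0,3),(1,1,7),(4,0,3),(4,4,7)}, B₂ = {(0,0,0),(0,0,2),(1,4,6),(2,2,7),(2,4,5),(3,1,5),(3,3,7),(4,1,6)}, B₃ = {(0,0,0),(0,0,3),(1,2,2),(1,3,5),(2,0,8),(3,0,8),(4,2,5),(4,3,2)}, B₄ = {(0,0,0),(0,0,4),(0,2,1),(0,3,1),(2,1,3),(2,3,8),(3,2,8),(3,4,3)} form a (225,8,1)-difference family: every nonzero element g of G has exactly one representation g = x − y with x, y belonging to the same block Bᵢ. -/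
def B8 : Fin 4 → Finset (ZMod 5 × ZMod 5 × ZMod 9) :=
  ![({(0, 0, 0), (0, 0, 1), (0, 1, 2), (0, 4, 2), (1, 0, 3), (1, 1, 7), (4, 0, 3), (4, 4, 7)} : Finset (ZMod 5 × ZMod 5 × ZMod 9)),
    ({(0, 0, 0), (0, 0, 2), (1, 4, 6), (2, 2, 7), (2, 4, 5), (3, 1, 5), (3, 3, 7), (4, 1, 6)} : Finset (ZMod 5 × ZMod 5 × ZMod 9)),
    ({(0, 0, 0), (0, 0, 3), (1, 2, 2), (1, 3, 5), (2, 0, 8), (3, 0, 8), (4, 2, 5), (4, 3, 2)} : Finset (ZMod 5 × ZMod 5 × ZMod 9)),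
    ({(0, 0, 0), (0, 0, 4), (0, 2, 1), (0, 3, 1), (2, 1, 3), (2, 3, 8), (3, 2, 8), (3, 4, 3)} : Finset (ZMod 5 × ZMod 5 × ZMod 9))]

theorem card_B8 : ∀ i : Fin 4, (B8 i).card = 8 := by
  decide +kernel

instance : Std.Commutative fun m n : ℕ => m ||| n := ⟨Nat.lor_comm⟩

instance : Std.Associative fun m n : ℕ => m ||| n := ⟨Nat.lor_assoc⟩

theorem testBit_fold_lor_two_pow {α : Type*} (s : Finset α) (f : α → ℕ) (n : ℕ) :
    (s.fold (fun m n : ℕ => m ||| n) 0 fun a => 2 ^ f a).testBit n = true ↔ ∃ a ∈ s, f a = n := by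
  classical
  induction s using Finset.induction_on with
  | empty => simp
  | insert a s ha ih => simp [Finset.fold_insert ha, ih, Nat.testBit_two_pow]

/-- Mixed-radix encoding of the group by the integers `0, …, 224`. -/
def groupCode (g : ZMod 5 × ZMod 5 × ZMod 9) : ℕ :=
  45 * g.1.val + 9 * g.2.1.val + g.2.2.val

theorem groupCode_injective : Function.Injective groupCode := by
  rintro ⟨a, b, c⟩ ⟨a', b', c'⟩ h
  have hb := ZMod.val_lt b
  have hb' := ZMod.val_lt b'
  have hc := ZMod.val_lt c
  have hc' := ZMod.val_lt c'
  simp only [groupCode] at h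
  rw [ZMod.val_injective 5 (show a.val = a'.val by omega),
    ZMod.val_injective 5 (show b.val = b'.val by omega),
    ZMod.val_injective 9 (show c.val = c'.val by omega)]

/-- The ordered pairs of distinct elements of a common block. -/
def blockPairs : Finset (Σ _ : Fin 4, (ZMod 5 × ZMod 5 × ZMod 9) × (ZMod 5 × ZMod 5 × ZMod 9)) :=
  Finset.univ.sigma fun i => (B8 i).offDiag

theorem card_blockPairs : blockPairs.card = 224 := by
  simp [blockPairs, Finset.offDiag_card, card_B8]

theorem fold_lor_blockPairs :
    (blockPairs.fold (fun m n : ℕ => m ||| n) 0 fun t => 2 ^ groupCode (t.2.1 - t.2.2)) = 2 ^ 225 - 2 := by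
  decide +kernel

theorem testBit_groupCode : ∀ g : ZMod 5 × ZMod 5 × ZMod 9, g ≠ 0 →
    (2 ^ 225 - 2).testBit (groupCode g) = true := by
  decide +kernel

theorem exists_blockPairs_sub_eq {g : ZMod 5 × ZMod 5 × ZMod 9} (hg : g ≠ 0) :
    ∃ t ∈ blockPairs, t.2.1 - t.2.2 = g := by
  have h := testBit_groupCode g hg
  rw [← fold_lor_blockPairs, testBit_fold_lor_two_pow] at h
  obtain ⟨t, ht, h⟩ := h
  exact ⟨t, ht, groupCode_injective h⟩

theorem injOn_sub_blockPairs :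
    Set.InjOn (fun t : Σ _ : Fin 4, (ZMod 5 × ZMod 5 × ZMod 9) × (ZMod 5 × ZMod 5 × ZMod 9) =>
      t.2.1 - t.2.2) blockPairs := by
  refine Finset.injOn_of_surjOn_of_card_le (t := Finset.univ.erase 0) _ ?_ ?_ ?_
  · rintro ⟨i, x, y⟩ h
    simpa [blockPairs, sub_eq_zero] using (Finset.mem_offDiag.mp (Finset.mem_sigma.mp h).2).2.2
  · intro g hg
    exact exists_blockPairs_sub_eq (by simpa using hg)
  · simp [card_blockPairs]

theorem stmt_8 :
    (∀ i : Fin 4, (B8 i).card = 8) ∧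
    ∀ g : ZMod 5 × ZMod 5 × ZMod 9, g ≠ 0 →
      ∃! t : Fin 4 × (ZMod 5 × ZMod 5 × ZMod 9) × (ZMod 5 × ZMod 5 × ZMod 9),
        t.2.1 ∈ B8 t.1 ∧ t.2.2 ∈ B8 t.1 ∧ t.2.1 - t.2.2 = g := by
  refine ⟨card_B8, fun g hg => ?_⟩
  have mem_pairs {i x y} (hx : x ∈ B8 i) (hy : y ∈ B8 i) (h : x - y = g) :
      (⟨i, x, y⟩ : Σ _ : Fin 4, _ × _) ∈ blockPairs := by
    simp only [blockPairs, Finset.mem_sigma, Finset.mem_univ, Finset.mem_offDiag, true_and]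
    exact ⟨hx, hy, sub_ne_zero.mp (h ▸ hg)⟩
  obtain ⟨⟨i, x, y⟩, ht, h⟩ := exists_blockPairs_sub_eq hg
  have hxy := Finset.mem_offDiag.mp (Finset.mem_sigma.mp ht).2
  refine ⟨(i, x, y), ⟨hxy.1, hxy.2.1, h⟩, ?_⟩
  rintro ⟨j, u, v⟩ ⟨hu, hv, huv⟩
  cases injOn_sub_blockPairs (mem_pairs hu hv huv) ht (huv.trans h.symm)
  rfl
end

section
/- In the abelian group G = ℤ/17 × ℤ/17 (of order 289), the four 9-element subsets B₁ = {(0,0),(0,1),(0,4),(1,5),(6,5),(12,12),(13,1),(13,6),(14,1)}, B₂ = {(0,0),(0,2),(2,15),(7,12),(8,9),(9,2),(10,0),(11,3),(13,12)}, B₃ = {(0,0),(0,6),(3,4),(9,13),(10,3),(10,12),(12,5),(12,15),(14,9)}, B₄ = {(0,0),(1,2),(4,9),(7,15),(8,11),(9,3),(10,11),(13,4),(15,1)} form a (289,9,1)-difference family: every nonzero element g of G has exactly one representation g = x − y with x, y belonging to the same block Bᵢ. -/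
def B12 : Fin 4 → Finset (ZMod 17 × ZMod 17) :=
  ![({(0, 0), (0, 1), (0, 4), (1, 5), (6, 5), (12, 12), (13, 1), (13, 6), (14, 1)} : Finset (ZMod 17 × ZMod 17)),
    ({(0, 0), (0, 2), (2, 15), (7, 12), (8, 9), (9, 2), (10, 0), (11, 3), (13, 12)} : Finset (ZMod 17 × ZMod 17)),
    ({(0, 0), (0, 6), (3, 4), (9, 13), (10, 3), (10, 12), (12, 5), (12, 15), (14, 9)} : Finset (ZMod 17 × ZMod 17)),
    ({(0, 0), (1, 2), (4, 9), (7, 15), (8, 11), (9, 3), (10, 11), (13, 4), (15, 1)} : Finset (ZMod 17 × ZMod 17))]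

theorem B12_card (i : Fin 4) : (B12 i).card = 9 := by
  revert i
  decide +kernel

theorem exists_sub_eq_of_ne_zero : ∀ g : ZMod 17 × ZMod 17, g ≠ 0 →
    ∃ i, ∃ x ∈ B12 i, ∃ y ∈ B12 i, x - y = g := by
  decide +kernel

theorem card_sigma_offDiag_B12 :
    ((Finset.univ : Finset (Fin 4)).sigma fun i => (B12 i).offDiag).card = 288 := by
  simp [Finset.card_sigma, Finset.offDiag_card, B12_card]

theorem card_compl_zero : ({0}ᶜ : Finset (ZMod 17 × ZMod 17)).card = 288 := by
  simp [Finset.card_compl, ZMod.card]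

/-- The blocks have as many ordered pairs of distinct elements as there are nonzero group elements,
so the surjective difference map is injective on them. -/
theorem injOn_sub_sigma_offDiag_B12 :
    Set.InjOn (fun t : Σ _ : Fin 4, (ZMod 17 × ZMod 17) × (ZMod 17 × ZMod 17) => t.2.1 - t.2.2)
      ((Finset.univ : Finset (Fin 4)).sigma fun i => (B12 i).offDiag) := by
  refine Finset.injOn_of_surjOn_of_card_le (t := {0}ᶜ) _ ?_ ?_ ?_
  · rintro ⟨i, x, y⟩ h
    simp only [Finset.coe_sigma, Set.mem_sigma_iff, Finset.mem_coe, Finset.mem_offDiag] at h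
    simpa [sub_eq_zero] using h.2.2.2
  · intro g hg
    have hg0 : g ≠ 0 := by simpa using hg
    obtain ⟨i, x, hx, y, hy, rfl⟩ := exists_sub_eq_of_ne_zero g hg0
    exact ⟨⟨i, x, y⟩, by simpa [hx, hy] using sub_ne_zero.mp hg0, rfl⟩
  · rw [card_sigma_offDiag_B12, card_compl_zero]

theorem stmt_12 :
    (∀ i : Fin 4, (B12 i).card = 9) ∧
    ∀ g : ZMod 17 × ZMod 17, g ≠ 0 →
      ∃! t : Fin 4 × (ZMod 17 × ZMod 17) × (ZMod 17 × ZMod 17),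
        t.2.1 ∈ B12 t.1 ∧ t.2.2 ∈ B12 t.1 ∧ t.2.1 - t.2.2 = g := by
  refine ⟨B12_card, fun g hg => ?_⟩
  obtain ⟨i, x, hx, y, hy, rfl⟩ := exists_sub_eq_of_ne_zero g hg
  refine ⟨(i, x, y), ⟨hx, hy, rfl⟩, ?_⟩
  rintro ⟨j, u, v⟩ ⟨hu, hv, huv⟩
  dsimp only at hu hv huv
  have huv0 : u ≠ v := sub_ne_zero.mp (huv ▸ hg)
  have h := injOn_sub_sigma_offDiag_B12 (x₁ := ⟨j, u, v⟩) (x₂ := ⟨i, x, y⟩)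
    (by simp [hu, hv, huv0]) (by simp [hx, hy, sub_ne_zero.mp hg]) huv
  cases h
  rfl
end
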